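/- Let V be a finite-dimensional real vector space, g a nondegenerate symmetric bilinear form on V, and O_g the group of linear automorphisms of V that preserve g, acting diagonally on the p-fold tensor power V⊗...⊗V (p factors). If p is even, then the real vector space of O_g-invariant linear forms on V⊗...⊗V is spanned by the linear forms g_σ, indexed by permutations σ of {1,...,p}, determined on decomposable tensors by g_σ(e1⊗...⊗ep) = g(e_{σ(1)}, e_{σ(2)}) · g(e_{σ(3)}, e_{σ(4)}) · ... · g(e_{σ(p-1)}, e_{σ(p)}). -/

import Mathlib

open TensorProduct PiTensorProduct
namespace OgInv
open Function Finset

/-- positivity of the operator `p (n-1) + ∑_{i≠j} τ_{ij}` -/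
theorem pair_sum {ι κ : Type} [Fintype ι] [DecidableEq ι] [Fintype κ] [DecidableEq κ]
    (c : (ι → κ) → ℝ) (i j : ι) (hij : i ≠ j) :
    ∑ x : κ × (ι → κ), (if x.2 i = x.2 j then c (update x.2 i x.1) * c (update x.2 j x.1) else 0)
      = ∑ w : ι → κ, c w * c (w ∘ Equiv.swap i j) := by
  rw [← Finset.sum_filter]
  refine Finset.sum_bij' (fun x _ => update x.2 i x.1) (fun w _ => (w i, update w i (w j)))
    ?_ ?_ ?_ ?_ ?_
  · intros; simp
  · intro w _; simp [hij, hij.symm]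
  · rintro ⟨b, w⟩ h
    simp only [mem_filter, mem_univ, true_and] at h
    simp [hij.symm, ← h]
  · intro w _; simp
  · rintro ⟨b, w⟩ h
    simp only [mem_filter, mem_univ, true_and] at h
    congr 2
    funext k
    simp only [comp_apply, update_apply, Equiv.swap_apply_def]
    by_cases h1 : k = i
    · subst h1; simp [hij, hij.symm, h]
    · by_cases h2 : k = j
      · subst h2; simp [h1]
      · simp [h1, h2]

theorem diag_sum {ι κ : Type} [Fintype ι] [DecidableEq ι] [Fintype κ] [DecidableEq κ]
    (c : (ι → κ) → ℝ) (i : ι) :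
    ∑ x : κ × (ι → κ), (c (update x.2 i x.1) * c (update x.2 i x.1))
      = Fintype.card κ * ∑ w : ι → κ, c w * c w := by
  have : (Fintype.card κ : ℝ) * ∑ w : ι → κ, c w * c w = ∑ x : κ × (ι → κ), c x.2 * c x.2 := by
    rw [Fintype.sum_prod_type]; simp
  rw [this]
  refine Finset.sum_bij' (fun x _ => (x.2 i, update x.2 i x.1)) (fun x _ => (x.2 i, update x.2 i x.1))
    ?_ ?_ ?_ ?_ ?_ <;> simp

theorem word_pos {ι κ : Type} [Fintype ι] [DecidableEq ι] [Fintype κ] [DecidableEq κ] [Nonempty ι]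
    (c : (ι → κ) → ℝ)
    (heven : ∀ w a, Odd (#{i | w i = a}) → c w = 0)
    (hT : ∀ w, (Fintype.card ι : ℝ) * (Fintype.card κ - 1) * c w
      + ∑ i, ∑ j ∈ univ.erase i, c (w ∘ Equiv.swap i j) = 0) : c = 0 := by
  have h1 : ∑ x : κ × (ι → κ), ∑ a, (∑ i, if x.2 i = a then c (update x.2 i x.1) else 0)^2
      = ∑ w, c w * ((Fintype.card ι : ℝ) * Fintype.card κ * c w
      + ∑ i, ∑ j ∈ univ.erase i, c (w ∘ Equiv.swap i j)) := by
    have e1 : ∀ x : κ × (ι → κ), ∑ a, (∑ i, if x.2 i = a then c (update x.2 i x.1) else 0)^2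
       = ∑ i, ∑ j, if x.2 i = x.2 j then c (update x.2 i x.1) * c (update x.2 j x.1) else 0 := by
      intro x
      simp_rw [sq, Finset.sum_mul_sum]
      rw [Finset.sum_comm]
      refine Finset.sum_congr rfl fun i _ => ?_
      rw [Finset.sum_comm]
      refine Finset.sum_congr rfl fun j _ => ?_
      simp [ite_mul, mul_ite, eq_comm]
    simp_rw [e1]
    rw [Finset.sum_comm]
    simp_rw [mul_add, Finset.mul_sum, Finset.sum_add_distrib]
    rw [Finset.sum_comm (s := (univ : Finset (ι → κ))) (t := (univ : Finset ι))]
    have e2 : ∑ w, c w * ((Fintype.card ι : ℝ) * Fintype.card κ * c w) =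
        ∑ i : ι, (Fintype.card κ * ∑ w : ι → κ, c w * c w) := by
      simp only [sum_const, card_univ, nsmul_eq_mul, mul_sum]
      refine Finset.sum_congr rfl fun w _ => ?_
      ring
    rw [e2, ← Finset.sum_add_distrib]
    refine Finset.sum_congr rfl fun i _ => ?_
    rw [Finset.sum_comm, ← Finset.add_sum_erase _ _ (mem_univ i),
      Finset.sum_comm (s := (univ : Finset (ι → κ)))]
    congr 1
    · rw [← diag_sum c i]; simp
    · refine Finset.sum_congr rfl fun j hj => ?_
      exact pair_sum c i j (Finset.ne_of_mem_erase hj).symm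
  have h2 : ∑ w, ∑ a, (∑ i, if w i = a then c w else 0)^2 ≤
     ∑ x : κ × (ι → κ), ∑ a, (∑ i, if x.2 i = a then c (update x.2 i x.1) else 0)^2 := by
    rw [Fintype.sum_prod_type, Finset.sum_comm (s := (univ : Finset κ))]
    refine Finset.sum_le_sum fun w _ => ?_
    rw [Finset.sum_comm]
    refine Finset.sum_le_sum fun a _ => ?_
    refine le_trans (le_of_eq ?_) (Finset.single_le_sum
      (f := fun b => (∑ i, if w i = a then c (update w i b) else 0)^2)
      (fun b _ => sq_nonneg _) (mem_univ a))
    congr 1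
    refine Finset.sum_congr rfl fun i _ => ?_
    split_ifs with h
    · rw [← h, update_eq_self]
    · rfl
  have h3 : ∀ w, 2 * (Fintype.card ι : ℝ) * (c w)^2 ≤ ∑ a, (∑ i, if w i = a then c w else 0)^2 := by
    intro w
    by_cases hw : c w = 0
    · simp [hw]
    have hm : (Fintype.card ι : ℝ) = ∑ a, (#{i | w i = a} : ℝ) := by
      have := Finset.card_eq_sum_card_fiberwise (f := w) (s := univ) (t := univ) (by simp)
      rw [Finset.card_univ] at this
      exact_mod_cast this
    rw [hm, Finset.mul_sum, Finset.sum_mul]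
    refine Finset.sum_le_sum fun a _ => ?_
    have hc : ∑ i, (if w i = a then c w else 0) = (#{i | w i = a} : ℝ) * c w := by
      rw [← Finset.sum_filter]; simp
    rw [hc, mul_pow]
    refine mul_le_mul_of_nonneg_right ?_ (sq_nonneg _)
    have hev : Even (#{i | w i = a}) := by
      by_contra hne
      exact hw (heven w a (Nat.not_even_iff_odd.mp hne))
    obtain ⟨k, hk⟩ := hev
    rw [hk]
    rcases Nat.eq_zero_or_pos k with h0 | h0
    · simp [h0]
    · have : (1 : ℝ) ≤ k := by exact_mod_cast h0
      push_cast
      nlinarith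
  have h4 := (Finset.sum_le_sum fun w (_ : w ∈ univ) => h3 w).trans h2
  rw [h1] at h4
  have h5 : ∀ w, c w * ((Fintype.card ι : ℝ) * Fintype.card κ * c w
      + ∑ i, ∑ j ∈ univ.erase i, c (w ∘ Equiv.swap i j)) = Fintype.card ι * (c w)^2 := by
    intro w
    have := hT w
    linear_combination (c w) * this
  simp_rw [h5, ← Finset.mul_sum] at h4
  have hp : (0 : ℝ) < Fintype.card ι := by exact_mod_cast Fintype.card_pos
  have h6 : ∑ w, (c w)^2 ≤ 0 := by nlinarith
  have h7 := (Finset.sum_eq_zero_iff_of_nonneg (fun w _ => sq_nonneg (c w))).mp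
    (le_antisymm h6 (Finset.sum_nonneg fun w _ => sq_nonneg _))
  funext w
  exact pow_eq_zero_iff (two_ne_zero) |>.mp (h7 w (mem_univ w))
/-- Infinitesimal invariance, via the Cayley transform. -/
theorem infinitesimal {ι V : Type*} [Fintype ι] [DecidableEq ι]
    [AddCommGroup V] [Module ℝ V] [FiniteDimensional ℝ V]
    (g : V →ₗ[ℝ] V →ₗ[ℝ] ℝ)
    (f : MultilinearMap ℝ (fun _ : ι => V) ℝ)
    (hinv : ∀ A : V ≃ₗ[ℝ] V, (∀ u v : V, g (A u) (A v) = g u v) →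
      ∀ e : ι → V, f (fun i => A (e i)) = f e)
    (X : V →ₗ[ℝ] V) (hX : ∀ u v, g (X u) v = - g u (X v)) (e : ι → V) :
    ∑ j, f (update e j (X (e j))) = 0 := by
  have key : ∀ t : ℝ, f (fun i => e i + t • X (e i))
      = ∑ s : Finset ι, t ^ #s * f (s.piecewise (fun i => X (e i)) e) := by
    intro t
    have := f.map_add_univ (fun i => t • X (e i)) e
    rw [show (fun i => t • X (e i)) + e = fun i => e i + t • X (e i) by
      funext i; simp [add_comm]] at this
    rw [this]
    refine Finset.sum_congr rfl fun s _ => ?_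
    have h2 := f.map_piecewise_smul (fun _ => t) (s.piecewise (fun i => X (e i)) e) s
    simp only [prod_const, smul_eq_mul] at h2
    rw [← h2]
    congr 1
    funext i
    by_cases hi : i ∈ s <;> simp [hi]
  -- group elements
  have hA : ∀ t : ℝ, ¬ Module.End.HasEigenvalue X t → ¬ Module.End.HasEigenvalue X (-t) → t ≠ 0 →
      f (fun i => e i + t⁻¹ • X (e i)) = f (fun i => e i + (-t⁻¹) • X (e i)) := by
    intro t ht ht' ht0
    let B : V →ₗ[ℝ] V := LinearMap.id + (-t⁻¹) • X
    let C : V →ₗ[ℝ] V := LinearMap.id + t⁻¹ • X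
    have hBC : ∀ u v, g (C u) (C v) = g (B u) (B v) := by
      intro u v
      simp only [B, C, LinearMap.add_apply, LinearMap.smul_apply, LinearMap.id_apply, map_add,
        map_smul, smul_eq_mul, hX]
      ring
    have inj : ∀ r : ℝ, r ≠ 0 → ¬ Module.End.HasEigenvalue X r →
        Injective (LinearMap.id + (-r⁻¹) • X : V →ₗ[ℝ] V) := by
      intro r hr hr'
      rw [injective_iff_map_eq_zero]
      intro v hv
      by_contra hv0
      apply hr'
      refine Module.End.hasEigenvalue_of_hasEigenvector (x := v) ⟨?_, hv0⟩
      rw [Module.End.mem_eigenspace_iff]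
      simp only [LinearMap.add_apply, LinearMap.smul_apply, LinearMap.id_apply] at hv
      rw [neg_smul] at hv
      have h1 : v = r⁻¹ • X v := by rwa [← sub_eq_add_neg, sub_eq_zero] at hv
      conv_rhs => rw [h1]
      rw [smul_smul, mul_inv_cancel₀ hr, one_smul]
    have hB : Injective B := inj t ht0 ht
    have hC : Injective C := by
      have := inj (-t) (neg_ne_zero.mpr ht0) ht'
      simpa [C, inv_neg] using this
    let eB := LinearEquiv.ofInjectiveEndo B hB
    let eC := LinearEquiv.ofInjectiveEndo C hC
    have heB : ∀ u, eB u = B u := fun u => rfl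
    have heC : ∀ u, eC u = C u := fun u => rfl
    have h1 := hinv (eB.symm.trans eC) (by
      intro u v
      simp only [LinearEquiv.trans_apply, heC, hBC]
      rw [← heB, ← heB]
      simp) (fun i => B (e i))
    simp only [LinearEquiv.trans_apply, ← heB, LinearEquiv.symm_apply_apply] at h1
    exact h1
  let Q : Polynomial ℝ := ∑ s : Finset ι,
    Polynomial.C ((1 - (-1) ^ #s) * f (s.piecewise (fun i => X (e i)) e)) * Polynomial.X ^ #s
  have hQ : Q = 0 := by
    have hfin : Set.Finite ({t | Module.End.HasEigenvalue X t} ∪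
        ((fun t : ℝ => -t) ⁻¹' {t | Module.End.HasEigenvalue X t}) ∪ {0}) := by
      refine Set.Finite.union (Set.Finite.union (Module.End.finite_hasEigenvalue X) ?_)
        (Set.finite_singleton 0)
      exact (Module.End.finite_hasEigenvalue X).preimage neg_injective.injOn
    have hinf := (hfin.infinite_compl).image (f := fun t : ℝ => t⁻¹) inv_injective.injOn
    refine Polynomial.eq_zero_of_infinite_isRoot Q (hinf.mono ?_)
    rintro _ ⟨t, ht, rfl⟩
    simp only [Set.mem_compl_iff, Set.mem_union, not_or, Set.mem_ofPred_eq, Set.mem_preimage,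
      Set.mem_singleton_iff] at ht
    have := hA t ht.1.1 ht.1.2 ht.2
    rw [key, key, ← sub_eq_zero, ← Finset.sum_sub_distrib] at this
    simp only [Set.mem_ofPred_eq, Polynomial.IsRoot, Q, Polynomial.eval_finsetSum]
    rw [← this]
    refine Finset.sum_congr rfl fun s _ => ?_
    simp only [Polynomial.eval_mul, Polynomial.eval_C, Polynomial.eval_pow, Polynomial.eval_X]
    rw [neg_pow t⁻¹]
    ring
  have h1 : Q.coeff 1 = 0 := by rw [hQ]; simp
  simp only [Q, Polynomial.finsetSum_coeff, Polynomial.coeff_C_mul, Polynomial.coeff_X_pow] at h1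
  have h2 : ∑ s : Finset ι, ((1 - (-1 : ℝ) ^ #s) * f (s.piecewise (fun i => X (e i)) e) *
      if 1 = #s then 1 else 0) = ∑ j, 2 * f (update e j (X (e j))) := by
    simp only [mul_ite, mul_one, mul_zero]
    rw [← Finset.sum_filter]
    symm
    refine Finset.sum_bij (fun j _ => {j}) ?_ ?_ ?_ ?_
    · simp
    · simp
    · intro s hs
      simp only [mem_filter, mem_univ, true_and] at hs
      obtain ⟨j, hj⟩ := Finset.card_eq_one.mp hs.symm
      exact ⟨j, mem_univ _, hj.symm⟩
    · intro j _
      rw [Finset.piecewise_singleton]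
      simp only [card_singleton]
      norm_num
  rw [h2, ← Finset.mul_sum] at h1
  simpa using h1

section
variable {V : Type*} [AddCommGroup V] [Module ℝ V]

/-- invariance of a multilinear form under the orthogonal group -/
def Inv (g : V →ₗ[ℝ] V →ₗ[ℝ] ℝ) {ι : Type} (f : MultilinearMap ℝ (fun _ : ι => V) ℝ) : Prop :=
  ∀ A : V ≃ₗ[ℝ] V, (∀ u v : V, g (A u) (A v) = g u v) → ∀ e : ι → V, f (fun i => A (e i)) = f e

/-- the forms `g_σ`, indexed by an arbitrary type -/
def Gen (g : V →ₗ[ℝ] V →ₗ[ℝ] ℝ) (m : ℕ) (ι : Type) : Set (MultilinearMap ℝ (fun _ : ι => V) ℝ) :=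
  {h | ∃ x y : Fin m → ι, Injective x ∧ Injective y ∧ (∀ k l, x k ≠ y l) ∧
    ∀ e, h e = ∏ k, g (e (x k)) (e (y k))}

theorem inv_of_mem_span (g : V →ₗ[ℝ] V →ₗ[ℝ] ℝ) (m : ℕ) {ι : Type}
    {h : MultilinearMap ℝ (fun _ : ι => V) ℝ} (hh : h ∈ Submodule.span ℝ (Gen g m ι)) :
    Inv g h := by
  intro A hA e
  induction hh using Submodule.span_induction with
  | mem h hh => obtain ⟨x, y, -, -, -, H⟩ := hh; simp [H, hA]
  | zero => simp
  | add a b _ _ ha hb => simp [ha, hb]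
  | smul r a _ ha => simp [ha]

/-- The operator `T = p (n-1) + ∑_{i ≠ j} τ_{ij}`. -/
noncomputable def T (r : ℝ) (ι : Type) [Fintype ι] [DecidableEq ι] :
    MultilinearMap ℝ (fun _ : ι => V) ℝ →ₗ[ℝ] MultilinearMap ℝ (fun _ : ι => V) ℝ :=
  r • LinearMap.id + ∑ i : ι, ∑ j ∈ univ.erase i,
    (MultilinearMap.domDomCongrLinearEquiv ℝ ℝ V ℝ (Equiv.swap i j)).toLinearMap

theorem T_apply (r : ℝ) {ι : Type} [Fintype ι] [DecidableEq ι]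
    (f : MultilinearMap ℝ (fun _ : ι => V) ℝ) (e : ι → V) :
    T r ι f e = r * f e + ∑ i : ι, ∑ j ∈ univ.erase i, f (e ∘ Equiv.swap i j) := by
  simp [T, LinearMap.sum_apply, _root_.sum_apply]
  rfl

theorem T_mem (g : V →ₗ[ℝ] V →ₗ[ℝ] ℝ) (m : ℕ) (r : ℝ) {ι : Type} [Fintype ι] [DecidableEq ι]
    {h : MultilinearMap ℝ (fun _ : ι => V) ℝ} (hh : h ∈ Submodule.span ℝ (Gen g m ι)) :
    T r ι h ∈ Submodule.span ℝ (Gen g m ι) := by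
  simp only [T, LinearMap.add_apply, LinearMap.smul_apply, LinearMap.id_apply, LinearMap.sum_apply]
  refine Submodule.add_mem _ (Submodule.smul_mem _ _ hh) ?_
  refine Submodule.sum_mem _ fun i _ => Submodule.sum_mem _ fun j _ => ?_
  have : Submodule.span ℝ (Gen g m ι) ≤ (Submodule.span ℝ (Gen g m ι)).comap
      (MultilinearMap.domDomCongrLinearEquiv ℝ ℝ V ℝ (Equiv.swap i j)).toLinearMap := by
    rw [Submodule.span_le]
    rintro h ⟨x, y, hx, hy, hxy, H⟩
    refine Submodule.subset_span ⟨Equiv.swap i j ∘ x, Equiv.swap i j ∘ y,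
      (Equiv.injective _).comp hx, (Equiv.injective _).comp hy, ?_, ?_⟩
    · intro k l hkl
      exact hxy k l ((Equiv.injective _) hkl)
    · intro e
      exact H _
  exact this hh

/-- multiplication by `g(e_i, e_j)` -/
noncomputable def G (g : V →ₗ[ℝ] V →ₗ[ℝ] ℝ) {ι : Type} [DecidableEq ι] (i j : ι) (hij : i ≠ j) :
    MultilinearMap ℝ (fun _ : {k : ι // k ≠ i ∧ k ≠ j} => V) ℝ →ₗ[ℝ]
      MultilinearMap ℝ (fun _ : ι => V) ℝ where
  toFun h := MultilinearMap.mk' (fun e => g (e i) (e j) * h (fun k => e k.1))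
    (by
      intro e k u v
      by_cases hi : k = i
      · subst hi
        have : ∀ z, (fun l : {l : ι // l ≠ k ∧ l ≠ j} => update e k z l.1) = fun l => e l.1 := by
          intro z; funext l; simp [l.2.1]
        simp [this, hij.symm, add_mul]
      by_cases hj : k = j
      · subst hj
        have : ∀ z, (fun l : {l : ι // l ≠ i ∧ l ≠ k} => update e k z l.1) = fun l => e l.1 := by
          intro z; funext l; simp [l.2.2]
        simp [this, hij, add_mul]
      · have : ∀ z, (fun l : {l : ι // l ≠ i ∧ l ≠ j} => update e k z l.1) =
            update (fun l => e l.1) ⟨k, hi, hj⟩ z := by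
          intro z; funext l; simp [update_apply, Subtype.ext_iff]
        simp [this, Ne.symm hi, Ne.symm hj, mul_add])
    (by
      intro e k r v
      by_cases hi : k = i
      · subst hi
        have : ∀ z, (fun l : {l : ι // l ≠ k ∧ l ≠ j} => update e k z l.1) = fun l => e l.1 := by
          intro z; funext l; simp [l.2.1]
        simp [this, hij.symm, mul_assoc]
      by_cases hj : k = j
      · subst hj
        have : ∀ z, (fun l : {l : ι // l ≠ i ∧ l ≠ k} => update e k z l.1) = fun l => e l.1 := by
          intro z; funext l; simp [l.2.2]
        simp [this, hij, mul_assoc]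
      · have : ∀ z, (fun l : {l : ι // l ≠ i ∧ l ≠ j} => update e k z l.1) =
            update (fun l => e l.1) ⟨k, hi, hj⟩ z := by
          intro z; funext l; simp [update_apply, Subtype.ext_iff]
        simp [this, Ne.symm hi, Ne.symm hj, mul_left_comm])
  map_add' a b := by ext e; simp [mul_add]
  map_smul' r a := by ext e; simp [mul_left_comm]

theorem G_apply (g : V →ₗ[ℝ] V →ₗ[ℝ] ℝ) {ι : Type} [DecidableEq ι] (i j : ι) (hij : i ≠ j)
    (h : MultilinearMap ℝ (fun _ : {k : ι // k ≠ i ∧ k ≠ j} => V) ℝ) (e : ι → V) :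
    G g i j hij h e = g (e i) (e j) * h (fun k => e k.1) := rfl

theorem G_mem (g : V →ₗ[ℝ] V →ₗ[ℝ] ℝ) (m : ℕ) {ι : Type} [DecidableEq ι] (i j : ι) (hij : i ≠ j)
    {h : MultilinearMap ℝ (fun _ : {k : ι // k ≠ i ∧ k ≠ j} => V) ℝ}
    (hh : h ∈ Submodule.span ℝ (Gen g m _)) :
    G g i j hij h ∈ Submodule.span ℝ (Gen g (m + 1) ι) := by
  have : Submodule.span ℝ (Gen g m _) ≤ (Submodule.span ℝ (Gen g (m+1) ι)).comap
      (G g i j hij) := by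
    rw [Submodule.span_le]
    rintro h ⟨x, y, hx, hy, hxy, H⟩
    refine Submodule.subset_span ⟨Fin.cons i (fun k => (x k).1), Fin.cons j (fun k => (y k).1),
      ?_, ?_, ?_, ?_⟩
    · rw [Fin.cons_injective_iff]
      refine ⟨?_, Subtype.val_injective.comp hx⟩
      rintro ⟨k, hk⟩
      exact (x k).2.1 hk
    · rw [Fin.cons_injective_iff]
      refine ⟨?_, Subtype.val_injective.comp hy⟩
      rintro ⟨k, hk⟩
      exact (y k).2.2 hk
    · intro k l
      refine Fin.cases ?_ (fun k => ?_) k <;> refine Fin.cases ?_ (fun l => ?_) l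
      · simpa using hij
      · simpa using (y l).2.1.symm
      · simpa using (x k).2.2
      · simpa [Subtype.ext_iff] using hxy k l
    · intro e
      rw [G_apply, H, Fin.prod_univ_succ]
      simp
  exact this hh

/-- contraction of the slots `i` and `j` -/
noncomputable def Con {κ : Type} [Fintype κ] (b : κ → V) (ε : κ → ℝ) {ι : Type} [DecidableEq ι]
    (i j : ι) (f : MultilinearMap ℝ (fun _ : ι => V) ℝ) :
    MultilinearMap ℝ (fun _ : {k : ι // k ≠ i ∧ k ≠ j} => V) ℝ :=
  ∑ a, (ε a)⁻¹ • f.domDomRestrict (fun k => k ≠ i ∧ k ≠ j) (fun _ => b a)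

theorem Con_apply {κ : Type} [Fintype κ] (b : κ → V) (ε : κ → ℝ) {ι : Type} [DecidableEq ι]
    (i j : ι) (f : MultilinearMap ℝ (fun _ : ι => V) ℝ) (e : ι → V) :
    Con b ε i j f (fun k => e k.1) =
      ∑ a, (ε a)⁻¹ * f (update (update e i (b a)) j (b a)) := by
  simp only [Con, _root_.sum_apply, _root_.smul_apply, smul_eq_mul,
    MultilinearMap.domDomRestrict_apply]
  refine Finset.sum_congr rfl fun a _ => ?_
  congr 2
  funext k
  by_cases hj : k = j
  · subst hj; simp
  · by_cases hi : k = i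
    · subst hi; simp [hj]
    · simp [hi, hj]

/-- orthogonal basis data -/
structure OB (g : V →ₗ[ℝ] V →ₗ[ℝ] ℝ) {κ : Type} [Fintype κ] [DecidableEq κ]
    (b : Module.Basis κ ℝ V) (ε : κ → ℝ) : Prop where
  ne : ∀ a, ε a ≠ 0
  sym : ∀ u v, g u v = g v u
  orth : ∀ a c, g (b a) (b c) = if a = c then ε a else 0

theorem OB.expand {g : V →ₗ[ℝ] V →ₗ[ℝ] ℝ} {κ : Type} [Fintype κ] [DecidableEq κ]
    {b : Module.Basis κ ℝ V} {ε : κ → ℝ} (H : OB g b ε) (v : V) :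
    ∑ a, ((ε a)⁻¹ * g (b a) v) • b a = v := by
  conv_rhs => rw [← b.sum_repr v]
  refine Finset.sum_congr rfl fun a _ => ?_
  congr 1
  have h1 : g (b a) v = ε a * b.repr v a := by
    conv_lhs => rw [← b.sum_repr v]
    simp only [map_sum, map_smul, H.orth, smul_eq_mul, mul_ite, mul_zero, Finset.sum_ite_eq,
      mem_univ, if_true]
    ring
  rw [h1, inv_mul_cancel_left₀ (H.ne a)]

theorem Con_inv {g : V →ₗ[ℝ] V →ₗ[ℝ] ℝ} {κ : Type} [Fintype κ] [DecidableEq κ]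
    {b : Module.Basis κ ℝ V} {ε : κ → ℝ} (H : OB g b ε) {ι : Type} [DecidableEq ι]
    (i j : ι) (hij : i ≠ j) (f : MultilinearMap ℝ (fun _ : ι => V) ℝ) (hf : Inv g f) :
    Inv g (Con b ε i j f) := by
  intro A hA e'
  obtain ⟨e, rfl⟩ : ∃ e : ι → V, (fun k : {k : ι // k ≠ i ∧ k ≠ j} => e k.1) = e' :=
    ⟨fun k => if h : k ≠ i ∧ k ≠ j then e' ⟨k, h⟩ else 0, by funext k; simp [k.2.1, k.2.2]⟩
  rw [Con_apply b ε i j f e, Con_apply b ε i j f (fun k => A (e k))]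
  have h1 : ∀ a, f (update (update e i (b a)) j (b a)) =
      f (update (update (fun k => A (e k)) i (A (b a))) j (A (b a))) := by
    intro a
    rw [← hf A hA]
    congr 1
    funext k
    simp only [update_apply]
    split_ifs <;> rfl
  simp_rw [h1]
  set E := fun k => A (e k)
  have h2 : ∀ a, A (b a) = ∑ c, ((ε c)⁻¹ * g (b c) (A (b a))) • b c := fun a => (H.expand _).symm
  have hs : ∀ c a, g (b c) (A (b a)) = g (b a) (A.symm (b c)) := by
    intro c a
    rw [H.sym (b a), ← hA (A.symm (b c)) (b a)]
    simp
  have h3 : ∀ c, b c = ∑ a, ((ε a)⁻¹ * g (b c) (A (b a))) • A (b a) := by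
    intro c
    have := congrArg A (H.expand (A.symm (b c)))
    simp only [map_sum, map_smul, A.apply_symm_apply] at this
    simp_rw [hs]
    exact this.symm
  symm
  calc ∑ a, (ε a)⁻¹ * f (update (update E i (A (b a))) j (A (b a)))
      = ∑ a, ∑ c, (ε a)⁻¹ * ((ε c)⁻¹ * g (b c) (A (b a)) *
          f (update (update E i (A (b a))) j (b c))) := by
        refine Finset.sum_congr rfl fun a _ => ?_
        conv_lhs => enter [2]; rw [congrArg (update (update E i (A (b a))) j) (h2 a)]
        rw [MultilinearMap.map_update_sum, Finset.mul_sum]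
        simp
    _ = ∑ c, (ε c)⁻¹ * f (update (update E i (b c)) j (b c)) := by
        rw [Finset.sum_comm]
        refine Finset.sum_congr rfl fun c _ => ?_
        have : f (update (update E i (b c)) j (b c)) =
            ∑ a, (ε a)⁻¹ * g (b c) (A (b a)) * f (update (update E i (A (b a))) j (b c)) := by
          rw [update_comm hij, congrArg (update (update E j (b c)) i) (h3 c),
            MultilinearMap.map_update_sum]
          refine Finset.sum_congr rfl fun a _ => ?_
          rw [MultilinearMap.map_update_smul, update_comm hij, smul_eq_mul]
        rw [this, Finset.mul_sum]
        refine Finset.sum_congr rfl fun a _ => ?_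
        ring

/-- the fundamental identity for one slot -/
theorem slot_identity [FiniteDimensional ℝ V]
    {g : V →ₗ[ℝ] V →ₗ[ℝ] ℝ} {κ : Type} [Fintype κ] [DecidableEq κ]
    {b : Module.Basis κ ℝ V} {ε : κ → ℝ} (H : OB g b ε) {ι : Type} [Fintype ι] [DecidableEq ι]
    (f : MultilinearMap ℝ (fun _ : ι => V) ℝ) (hf : Inv g f) (i : ι) (e : ι → V) :
    ((Fintype.card κ : ℝ) - 1) * f e + ∑ j ∈ univ.erase i, f (e ∘ Equiv.swap i j)
      = ∑ j ∈ univ.erase i, g (e i) (e j) * Con b ε i j f (fun k => e k.1) := by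
  let X : κ → V →ₗ[ℝ] V := fun a =>
    (g (e i)).smulRight ((ε a)⁻¹ • b a) - (g ((ε a)⁻¹ • b a)).smulRight (e i)
  have hXa : ∀ a v, X a v = (g (e i) v * (ε a)⁻¹) • b a - ((ε a)⁻¹ * g (b a) v) • e i := by
    intro a v; simp [X, smul_smul]
  have h0 : ∀ a, ∑ j, f (update (update e i (b a)) j (X a (update e i (b a) j))) = 0 := by
    intro a
    refine infinitesimal g f hf (X a) ?_ _
    intro u v
    simp only [hXa, map_sub, map_smul, LinearMap.sub_apply, LinearMap.smul_apply, smul_eq_mul]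
    rw [H.sym u (b a), H.sym u (e i)]
    ring
  have h1 : ∑ a, ∑ j, f (update (update e i (b a)) j (X a (update e i (b a) j))) = 0 :=
    Finset.sum_eq_zero fun a _ => h0 a
  rw [Finset.sum_comm, ← Finset.add_sum_erase _ _ (mem_univ i)] at h1
  have h2 : ∑ a, f (update (update e i (b a)) i (X a (update e i (b a) i)))
      = f e - Fintype.card κ * f e := by
    have : ∀ a, f (update (update e i (b a)) i (X a (update e i (b a) i))) =
        f (update e i (((ε a)⁻¹ * g (b a) (e i)) • b a)) - f e := by
      intro a
      rw [update_idem, update_self, hXa, MultilinearMap.map_update_sub]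
      rw [H.orth, if_pos rfl, inv_mul_cancel₀ (H.ne a), one_smul, update_eq_self, H.sym (e i),
        mul_comm]
    simp_rw [this, Finset.sum_sub_distrib]
    rw [← MultilinearMap.map_update_sum, H.expand, update_eq_self]
    simp
  have h3 : ∀ j ∈ univ.erase i, ∑ a, f (update (update e i (b a)) j (X a (update e i (b a) j)))
      = g (e i) (e j) * Con b ε i j f (fun k => e k.1) - f (e ∘ Equiv.swap i j) := by
    intro j hj
    have hji : j ≠ i := Finset.ne_of_mem_erase hj
    have h4 : f (e ∘ Equiv.swap i j) =
        ∑ a, ((ε a)⁻¹ * g (b a) (e j)) * f (update (update e i (b a)) j (e i)) := by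
      have : e ∘ Equiv.swap i j = update (update e j (e i)) i (e j) := by
        funext k
        simp only [comp_apply, update_apply, Equiv.swap_apply_def]
        split_ifs <;> rfl
      rw [this, congrArg (update (update e j (e i)) i) (H.expand (e j)).symm,
        MultilinearMap.map_update_sum]
      refine Finset.sum_congr rfl fun a _ => ?_
      rw [MultilinearMap.map_update_smul, update_comm hji, smul_eq_mul]
    rw [Con_apply, h4, Finset.mul_sum, ← Finset.sum_sub_distrib]
    refine Finset.sum_congr rfl fun a _ => ?_
    rw [update_of_ne hji, hXa, MultilinearMap.map_update_sub, MultilinearMap.map_update_smul,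
      MultilinearMap.map_update_smul]
    simp only [smul_eq_mul]
    ring
  rw [h2, Finset.sum_congr rfl h3, Finset.sum_sub_distrib] at h1
  linarith

/-- words with a letter of odd multiplicity have zero coefficient -/
theorem odd_zero {g : V →ₗ[ℝ] V →ₗ[ℝ] ℝ} {κ : Type} [Fintype κ] [DecidableEq κ]
    {b : Module.Basis κ ℝ V} {ε : κ → ℝ} (H : OB g b ε) {ι : Type} [Fintype ι]
    (f : MultilinearMap ℝ (fun _ : ι => V) ℝ) (hf : Inv g f) (w : ι → κ) (a : κ)
    (ho : Odd (#{i | w i = a})) : f (fun i => b (w i)) = 0 := by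
  let φ : Module.Dual ℝ V := (2 * (ε a)⁻¹) • g (b a)
  have hφ : φ (b a) = 2 := by
    simp [φ, H.orth, H.ne a]
  have h1 := hf (Module.reflection hφ) (by
    intro u v
    have haa : g (b a) (b a) = ε a := by simp [H.orth]
    have := H.ne a
    simp only [Module.reflection_apply, map_sub, map_smul, LinearMap.sub_apply,
      LinearMap.smul_apply, smul_eq_mul, φ, haa]
    rw [H.sym u (b a)]
    field_simp
    ring) (fun i => b (w i))
  have h2 : ∀ i, Module.reflection hφ (b (w i)) = (if w i = a then (-1 : ℝ) else 1) • b (w i) := by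
    intro i
    split_ifs with h
    · rw [h]; simp
    · rw [Module.reflection_apply]
      simp [φ, H.orth, Ne.symm h]
  simp_rw [h2] at h1
  rw [MultilinearMap.map_smul_univ, Finset.prod_ite] at h1
  simp only [prod_const, one_pow, mul_one, ho.neg_one_pow, smul_eq_mul] at h1
  linarith

theorem T_inj {g : V →ₗ[ℝ] V →ₗ[ℝ] ℝ} {κ : Type} [Fintype κ] [DecidableEq κ]
    {b : Module.Basis κ ℝ V} {ε : κ → ℝ} (H : OB g b ε) {ι : Type} [Fintype ι] [DecidableEq ι]
    [Nonempty ι]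
    (f : MultilinearMap ℝ (fun _ : ι => V) ℝ) (hf : Inv g f)
    (h : T ((Fintype.card ι : ℝ) * (Fintype.card κ - 1)) ι f = 0) : f = 0 := by
  have := word_pos (fun w : ι → κ => f (fun i => b (w i))) (fun w a => odd_zero H f hf w a) (by
    intro w
    have := T_apply ((Fintype.card ι : ℝ) * (Fintype.card κ - 1)) f (fun i => b (w i))
    rw [h] at this
    exact this.symm)
  refine Module.Basis.ext_multilinear (fun _ => b) fun w => ?_
  exact congrFun this w

theorem surj_aux {E : Type*} [AddCommGroup E] [Module ℝ E] [FiniteDimensional ℝ E]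
    (L : E →ₗ[ℝ] E) (S : Submodule ℝ E) (hS : ∀ x ∈ S, L x ∈ S) (hL : ∀ x ∈ S, L x = 0 → x = 0) :
    ∀ y ∈ S, ∃ x ∈ S, L x = y := by
  intro y hy
  have hinj : Injective (L.restrict hS) := by
    rw [injective_iff_map_eq_zero]
    intro x hx
    exact Subtype.ext (hL x.1 x.2 (congrArg Subtype.val hx))
  obtain ⟨x, hx⟩ := (LinearMap.injective_iff_surjective.mp hinj) ⟨y, hy⟩
  exact ⟨x.1, x.2, congrArg Subtype.val hx⟩

theorem main_aux [FiniteDimensional ℝ V]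
    {g : V →ₗ[ℝ] V →ₗ[ℝ] ℝ} {κ : Type} [Fintype κ] [DecidableEq κ]
    {b : Module.Basis κ ℝ V} {ε : κ → ℝ} (H : OB g b ε) (m : ℕ) :
    ∀ (ι : Type) [Fintype ι] [DecidableEq ι], Fintype.card ι = 2 * m →
    ∀ f : MultilinearMap ℝ (fun _ : ι => V) ℝ, Inv g f → f ∈ Submodule.span ℝ (Gen g m ι) := by
  induction m with
  | zero =>
    intro ι _ _ hc f hf
    have : IsEmpty ι := Fintype.card_eq_zero_iff.mp (by simpa using hc)
    have h1 : f = (f 0) • MultilinearMap.constOfIsEmpty ℝ (fun _ : ι => V) (1 : ℝ) := by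
      ext e
      rw [Subsingleton.elim e 0]
      simp
    rw [h1]
    refine Submodule.smul_mem _ _ (Submodule.subset_span ?_)
    refine ⟨Fin.elim0, Fin.elim0, fun k => k.elim0, fun k => k.elim0, fun k => k.elim0, ?_⟩
    intro e
    simp
  | succ m ih =>
    intro ι _ _ hc f hf
    have : Nonempty ι := Fintype.card_pos_iff.mp (by omega)
    set r : ℝ := (Fintype.card ι : ℝ) * (Fintype.card κ - 1) with hr
    have hT : T r ι f ∈ Submodule.span ℝ (Gen g (m + 1) ι) := by
      have h1 : T r ι f = ∑ i : ι, ∑ j ∈ (univ.erase i).attach,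
          G g i j.1 (Finset.ne_of_mem_erase j.2).symm (Con b ε i j.1 f) := by
        ext e
        rw [T_apply]
        simp only [_root_.sum_apply, G_apply]
        have h2 : r * f e = ∑ i : ι, ((Fintype.card κ : ℝ) - 1) * f e := by
          simp [hr, mul_assoc]
        rw [h2, ← Finset.sum_add_distrib]
        refine Finset.sum_congr rfl fun i _ => ?_
        rw [slot_identity H f hf i e]
        exact (Finset.sum_attach (univ.erase i)
          (fun j => g (e i) (e j) * Con b ε i j f (fun k => e k.1))).symm
      rw [h1]
      refine Submodule.sum_mem _ fun i _ => Submodule.sum_mem _ fun j _ => ?_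
      have hij : i ≠ j.1 := (Finset.ne_of_mem_erase j.2).symm
      refine G_mem g m i j.1 hij (ih _ ?_ _ (Con_inv H i j.1 hij f hf))
      have h3 : Fintype.card {k : ι // k ≠ i ∧ k ≠ j.1} = #((univ.erase i).erase j.1) := by
        rw [Fintype.card_subtype]
        congr 1
        ext k
        simp [and_comm]
      rw [h3, Finset.card_erase_of_mem j.2, Finset.card_erase_of_mem (mem_univ _), card_univ, hc]
      omega
    have hfin : FiniteDimensional ℝ (MultilinearMap ℝ (fun _ : ι => V) ℝ) := inferInstance
    obtain ⟨s, hsm, hs'⟩ := surj_aux (T r ι) (Submodule.span ℝ (Gen g (m + 1) ι))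
      (fun x hx => T_mem g (m + 1) r hx)
      (fun x hx h4 => T_inj H x (inv_of_mem_span g (m + 1) hx) h4) _ hT
    have h5 : f - s = 0 := by
      refine T_inj H (f - s) ?_ ?_
      · intro A hA e
        have h6 := hf A hA e
        have h7 := inv_of_mem_span g (m + 1) hsm A hA e
        simp only [sub_apply, h6, h7]
      · rw [map_sub, hs', sub_self]
    rw [sub_eq_zero.mp h5]
    exact hsm
end
end OgInv

/-- if `p = 2m` is even, the space of linear forms on the `p`-fold tensor
power of `V` invariant under the diagonal action of the orthogonal group `O_g` of a
nondegenerate symmetric bilinear form `g` is spanned by the forms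
`g_σ(e₁ ⊗ ... ⊗ e_p) = ∏ᵢ g(e_{σ(2i-1)}, e_{σ(2i)})`, for `σ` a permutation of `{1,...,p}`. -/
theorem invariant_forms_even_tensor_power_spanned_by_g_sigma
    {V : Type*} [AddCommGroup V] [Module ℝ V] [FiniteDimensional ℝ V]
    (g : V →ₗ[ℝ] V →ₗ[ℝ] ℝ)
    (hsym : ∀ u v : V, g u v = g v u)
    (hnondeg : ∀ u : V, (∀ v : V, g u v = 0) → u = 0)
    (m : ℕ)
    (f : (⨂[ℝ]^(2 * m) V) →ₗ[ℝ] ℝ)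
    (hinv : ∀ A : V ≃ₗ[ℝ] V, (∀ u v : V, g (A u) (A v) = g u v) →
      ∀ e : Fin (2 * m) → V,
        f (PiTensorProduct.tprod ℝ (fun i => A (e i))) = f (PiTensorProduct.tprod ℝ e)) :
    f ∈ Submodule.span ℝ
      {h : (⨂[ℝ]^(2 * m) V) →ₗ[ℝ] ℝ |
        ∃ σ : Equiv.Perm (Fin (2 * m)), ∀ e : Fin (2 * m) → V,
          h (PiTensorProduct.tprod ℝ e) =
            ∏ i : Fin m,
              g (e (σ ⟨2 * (i : ℕ), by have := i.isLt; omega⟩))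
                (e (σ ⟨2 * (i : ℕ) + 1, by have := i.isLt; omega⟩))} := by
  obtain ⟨b, hb⟩ := LinearMap.BilinForm.exists_orthogonal_basis (B := g) ⟨fun u v => hsym u v⟩
  have hb' : ∀ a c, a ≠ c → g (b a) (b c) = 0 := fun a c hac => hb hac
  have H : OgInv.OB g b (fun a => g (b a) (b a)) := by
    refine ⟨?_, hsym, ?_⟩
    · intro a ha
      apply b.ne_zero a
      apply hnondeg
      intro v
      rw [← b.sum_repr v, map_sum]
      refine Finset.sum_eq_zero fun c _ => ?_
      rw [map_smul]
      by_cases hac : a = c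
      · rw [← hac, ha, smul_zero]
      · rw [hb' a c hac, smul_zero]
    · intro a c
      split_ifs with hac
      · rw [hac]
      · exact hb' a c hac
  have h1 := OgInv.main_aux H m (Fin (2 * m)) (by simp) (PiTensorProduct.lift.symm f) (by
    intro A hA e
    exact hinv A hA e)
  have h2 : Submodule.span ℝ (OgInv.Gen g m (Fin (2 * m))) ≤ (Submodule.span ℝ
      {h : (⨂[ℝ]^(2 * m) V) →ₗ[ℝ] ℝ |
        ∃ σ : Equiv.Perm (Fin (2 * m)), ∀ e : Fin (2 * m) → V,
          h (PiTensorProduct.tprod ℝ e) =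
            ∏ i : Fin m,
              g (e (σ ⟨2 * (i : ℕ), by have := i.isLt; omega⟩))
                (e (σ ⟨2 * (i : ℕ) + 1, by have := i.isLt; omega⟩))}).comap
      (PiTensorProduct.lift (R := ℝ) (s := fun _ : Fin (2 * m) => V) (E := ℝ)).toLinearMap := by
    rw [Submodule.span_le]
    rintro h ⟨x, y, hx, hy, hxy, hh⟩
    refine Submodule.subset_span ?_
    let s : Fin (2 * m) → Fin (2 * m) := fun k =>
      if k.1 % 2 = 0 then x ⟨k.1 / 2, by omega⟩ else y ⟨k.1 / 2, by omega⟩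
    have hs : Function.Injective s := by
      intro k l hkl
      simp only [s] at hkl
      split_ifs at hkl with h1 h2 h2
      · have := congrArg Fin.val (hx hkl); simp only at this; ext; omega
      · exact absurd hkl (hxy _ _)
      · exact absurd hkl.symm (hxy _ _)
      · have := congrArg Fin.val (hy hkl); simp only at this; ext; omega
    refine ⟨Equiv.ofBijective s (Finite.injective_iff_bijective.mp hs), fun e => ?_⟩
    have h3 : ∀ i : Fin m, s ⟨2 * (i : ℕ), by have := i.isLt; omega⟩ = x i := by
      intro i; simp [s]
    have h4 : ∀ i : Fin m, s ⟨2 * (i : ℕ) + 1, by have := i.isLt; omega⟩ = y i := by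
      intro i
      have h5 : (2 * (i : ℕ) + 1) / 2 = i := by omega
      have h6 : ¬ (2 * (i : ℕ) + 1) % 2 = 0 := by omega
      simp [s, h5]
    simp only [Equiv.ofBijective_apply, h3, h4]
    rw [← hh e]
    exact PiTensorProduct.lift.tprod e
  have h3 := h2 h1
  rw [Submodule.mem_comap] at h3
  have h4 : PiTensorProduct.lift (PiTensorProduct.lift.symm f) = f :=
    LinearEquiv.apply_symm_apply _ f
  rw [← h4]
  exact h3
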